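/- Let d be an odd natural number with b(d) = 3 and b(3d) = 6. Then d = 2^m + 2^p + 1 for some natural numbers m, p with m > p + 1 > 2 (i.e., p ≥ 2 and m ≥ p + 2). -/

import Mathlib

/-- `binOnes n` is the number of 1s in the binary expansion of `n`. -/
def binOnes (n : ℕ) : ℕ := (Nat.digits 2 n).count 1

theorem binOnes_zero : binOnes 0 = 0 := by simp [binOnes]

theorem binOnes_two_mul (n : ℕ) : binOnes (2 * n) = binOnes n := by
  rcases Nat.eq_zero_or_pos n with rfl | hn
  · rfl
  · simp [binOnes, Nat.digits_def' one_lt_two (show 0 < 2 * n by omega)]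

theorem binOnes_two_mul_add_one (n : ℕ) : binOnes (2 * n + 1) = binOnes n + 1 := by
  have h : (2 * n + 1) / 2 = n := by omega
  simp [binOnes, h]

theorem binOnes_two_pow_mul (i n : ℕ) : binOnes (2 ^ i * n) = binOnes n := by
  induction i with
  | zero => simp
  | succ i ih => rw [pow_succ', mul_assoc, binOnes_two_mul, ih]

theorem binOnes_add_one_le (n : ℕ) : binOnes (n + 1) ≤ binOnes n + 1 := by
  induction n using Nat.strong_induction_on with
  | _ n ih =>
    obtain ⟨k, rfl | rfl⟩ := Nat.even_or_odd' n
    · rw [binOnes_two_mul_add_one, binOnes_two_mul]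
    · have := ih k (by omega)
      rw [show 2 * k + 1 + 1 = 2 * (k + 1) by ring, binOnes_two_mul, binOnes_two_mul_add_one]
      omega

theorem binOnes_add_le (a b : ℕ) : binOnes (a + b) ≤ binOnes a + binOnes b := by
  induction a using Nat.strong_induction_on generalizing b with
  | _ a ih =>
    rcases Nat.eq_zero_or_pos a with rfl | ha
    · simp
    obtain ⟨k, rfl | rfl⟩ := Nat.even_or_odd' a <;> obtain ⟨l, rfl | rfl⟩ := Nat.even_or_odd' b <;>
      have := ih k (by omega) l
    · rw [← mul_add]
      simpa only [binOnes_two_mul]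
    · rw [← add_assoc, ← mul_add]
      simp only [binOnes_two_mul, binOnes_two_mul_add_one]
      omega
    · rw [show 2 * k + 1 + 2 * l = 2 * (k + l) + 1 by ring]
      simp only [binOnes_two_mul, binOnes_two_mul_add_one]
      omega
    · have := binOnes_add_one_le (k + l)
      rw [show 2 * k + 1 + (2 * l + 1) = 2 * (k + l + 1) by ring]
      simp only [binOnes_two_mul, binOnes_two_mul_add_one]
      omega

theorem exists_two_pow_mul_of_binOnes_eq_succ {n k : ℕ} (h : binOnes n = k + 1) :
    ∃ i q, n = 2 ^ i * (2 * q + 1) ∧ binOnes q = k := by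
  have hn : n ≠ 0 := by
    rintro rfl
    simp [binOnes_zero] at h
  obtain ⟨i, m, ⟨q, rfl⟩, rfl⟩ := Nat.exists_eq_two_pow_mul_odd hn
  refine ⟨i, q, rfl, ?_⟩
  rw [binOnes_two_pow_mul, binOnes_two_mul_add_one] at h
  omega

theorem eq_zero_of_binOnes_eq_zero {n : ℕ} (h : binOnes n = 0) : n = 0 := by
  by_contra hn
  obtain ⟨i, m, ⟨q, rfl⟩, rfl⟩ := Nat.exists_eq_two_pow_mul_odd hn
  rw [binOnes_two_pow_mul, binOnes_two_mul_add_one] at h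
  omega

theorem odd_three_ones (d : ℕ) (hodd : Odd d) (hb : binOnes d = 3)
    (hb3 : binOnes (3 * d) = 6) :
    ∃ m p : ℕ, 2 ≤ p ∧ p + 2 ≤ m ∧ d = 2 ^ m + 2 ^ p + 1 := by
  obtain ⟨q, rfl⟩ := hodd
  rw [binOnes_two_mul_add_one] at hb
  obtain ⟨i, r, rfl, hr⟩ := exists_two_pow_mul_of_binOnes_eq_succ (Nat.succ.inj hb)
  obtain ⟨j, s, rfl, hs⟩ := exists_two_pow_mul_of_binOnes_eq_succ hr
  obtain rfl := eq_zero_of_binOnes_eq_zero hs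
  have h3 : binOnes 3 = 2 := by simp [binOnes]
  have h9 : binOnes 9 = 2 := by simp [binOnes]
  have hi : i ≠ 0 := by
    rintro rfl
    have := binOnes_add_le 9 (2 ^ (j + 2) * 3)
    rw [binOnes_two_pow_mul, h3, h9, show 9 + 2 ^ (j + 2) * 3 =
      3 * (2 * (2 ^ 0 * (2 * (2 ^ j * (2 * 0 + 1)) + 1)) + 1) by ring] at this
    omega
  have hj : j ≠ 0 := by
    rintro rfl
    have := binOnes_add_le 3 (2 ^ (i + 1) * 9)
    rw [binOnes_two_pow_mul, h3, h9, show 3 + 2 ^ (i + 1) * 9 =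
      3 * (2 * (2 ^ i * (2 * (2 ^ 0 * (2 * 0 + 1)) + 1)) + 1) by ring] at this
    omega
  exact ⟨i + j + 2, i + 1, by omega, by omega, by ring⟩
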